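/- Let 1 ≤ m < n be integers, 0 < s ≤ m, and let μ be a compactly supported Borel probability measure on ℝ^n whose support is contained in an s-Ahlfors regular set. Let ν be a compactly supported Borel probability measure on ℝ^n with supp ν ⊆ supp μ and ν absolutely continuous with respect to μ. Let q > 0. Then for ν-almost every x, liminf_{r→0⁺} [log ν∗φ_r^m(x) − q log μ∗φ_r^m(x)]/log r = liminf_{r→0⁺} [log ν(B(x,r)) − q log μ(B(x,r))]/log r. -/

import Mathlib

open MeasureTheory Metric Set Filter
open scoped NNReal ENNReal Topology

/-- The topological support of a measure. -/
def measureSupport {n : ℕ} (μ : Measure (EuclideanSpace ℝ (Fin n))) :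
    Set (EuclideanSpace ℝ (Fin n)) :=
  {x | ∀ U : Set (EuclideanSpace ℝ (Fin n)), IsOpen U → x ∈ U → 0 < μ U}

/-- The convolution `μ∗φ_r^m(x) = ∫ min {1, r^m |x-y|^{-m}} dμ(y)`, with the
integrand equal to `1` when `y = x`. -/
noncomputable def convPhi {n : ℕ} (m : ℕ) (μ : Measure (EuclideanSpace ℝ (Fin n)))
    (x : EuclideanSpace ℝ (Fin n)) (r : ℝ) : ℝ :=
  ∫ y, (if ‖x - y‖ = 0 then 1 else min 1 (r ^ m / ‖x - y‖ ^ m)) ∂μ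

/-- A closed set `F ⊆ ℝ^n` is `s`-Ahlfors regular if there are a Borel measure `λ`
and a constant `1 ≤ C < ∞` with `λ F > 0` and `C⁻¹ r^s ≤ λ(B(x,r)) ≤ C r^s` for all
`x ∈ F` and `0 < r ≤ 1`. -/
def IsAhlforsRegular {n : ℕ} (s : ℝ) (F : Set (EuclideanSpace ℝ (Fin n))) : Prop :=
  IsClosed F ∧ ∃ (lam : Measure (EuclideanSpace ℝ (Fin n))) (C : ℝ), 1 ≤ C ∧ 0 < lam F ∧
    ∀ x ∈ F, ∀ r : ℝ, 0 < r → r ≤ 1 →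
      ENNReal.ofReal (C⁻¹ * r ^ s) ≤ lam (ball x r) ∧ lam (ball x r) ≤ ENNReal.ofReal (C * r ^ s)

/-- `liminf_{r → 0⁺} [log ν∗φ_r^m(x) − q log μ∗φ_r^m(x)] / log r`. -/
noncomputable def alphaConv {n : ℕ} (q : ℝ) (m : ℕ)
    (μ ν : Measure (EuclideanSpace ℝ (Fin n))) (x : EuclideanSpace ℝ (Fin n)) : ℝ :=
  Filter.liminf
    (fun r : ℝ =>
      (Real.log (convPhi m ν x r) - q * Real.log (convPhi m μ x r)) / Real.log r)
    (𝓝[>] (0 : ℝ))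

/-- `liminf_{r → 0⁺} [log ν(B(x,r)) − q log μ(B(x,r))] / log r`. -/
noncomputable def alphaBall {n : ℕ} (q : ℝ)
    (μ ν : Measure (EuclideanSpace ℝ (Fin n))) (x : EuclideanSpace ℝ (Fin n)) : ℝ :=
  Filter.liminf
    (fun r : ℝ =>
      (Real.log (ν (ball x r)).toReal - q * Real.log (μ (ball x r)).toReal) / Real.log r)
    (𝓝[>] (0 : ℝ))

section Helpers

variable {n : ℕ}

/-- Kernel as a function of the distance. -/
noncomputable def gk (m : ℕ) (r d : ℝ) : ℝ := (r / max r d) ^ m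

/-- Extended nonnegative convolution. -/
noncomputable def AA (m : ℕ) (μ : Measure (EuclideanSpace ℝ (Fin n))) (r : ℝ)
    (x : EuclideanSpace ℝ (Fin n)) : ℝ≥0∞ :=
  ∫⁻ y, ENNReal.ofReal (gk m r (dist x y)) ∂μ

lemma gk_nonneg (m : ℕ) {r : ℝ} (hr : 0 < r) (d : ℝ) : 0 ≤ gk m r d := by
  unfold gk
  have : 0 < max r d := lt_max_of_lt_left hr
  positivity

lemma gk_base_le_one {r : ℝ} (hr : 0 < r) (d : ℝ) : r / max r d ≤ 1 := by
  have : 0 < max r d := lt_max_of_lt_left hr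
  rw [div_le_one this]
  exact le_max_left _ _

lemma gk_base_pos {r : ℝ} (hr : 0 < r) (d : ℝ) : 0 < r / max r d := by
  have : 0 < max r d := lt_max_of_lt_left hr
  positivity

lemma gk_le_one (m : ℕ) {r : ℝ} (hr : 0 < r) (d : ℝ) : gk m r d ≤ 1 :=
  pow_le_one₀ (gk_base_pos hr d).le (gk_base_le_one hr d)

lemma gk_eq (m : ℕ) {r : ℝ} (hr : 0 < r) {d : ℝ} (hd : 0 ≤ d) :
    (if d = 0 then 1 else min 1 (r ^ m / d ^ m)) = gk m r d := by
  unfold gk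
  split_ifs with h
  · rw [h, max_eq_left hr.le, div_self hr.ne', one_pow]
  · have hd' : 0 < d := lt_of_le_of_ne hd (Ne.symm h)
    rw [← div_pow]
    rcases le_total r d with hrd | hrd
    · rw [max_eq_right hrd, min_eq_right]
      exact pow_le_one₀ (by positivity) ((div_le_one hd').2 hrd)
    · rw [max_eq_left hrd, div_self hr.ne', one_pow, min_eq_left]
      exact one_le_pow₀ ((one_le_div hd').2 hrd)

lemma gk_meas (m : ℕ) (r : ℝ) :
    Measurable (fun p : EuclideanSpace ℝ (Fin n) × EuclideanSpace ℝ (Fin n) =>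
      ENNReal.ofReal (gk m r (dist p.1 p.2))) := by
  unfold gk
  fun_prop

lemma gk_mono (m : ℕ) {r t : ℝ} (hr : 0 < r) (hrt : r ≤ t) (d : ℝ) : gk m r d ≤ gk m t d := by
  unfold gk
  have ht : 0 < t := hr.trans_le hrt
  apply pow_le_pow_left₀ (gk_base_pos hr d).le
  have h1 : 0 < max r d := lt_max_of_lt_left hr
  have h2 : 0 < max t d := lt_max_of_lt_left ht
  rw [div_le_div_iff₀ h1 h2]
  rcases le_total t d with h | h
  · rw [max_eq_right h, max_eq_right (hrt.trans h)]
    exact mul_le_mul_of_nonneg_right hrt (ht.le.trans h)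
  · rw [max_eq_left h]
    nlinarith [le_max_left r d]

lemma gk_double (m : ℕ) {r : ℝ} (hr : 0 < r) (d : ℝ) :
    gk m (2 * r) d ≤ 2 ^ m * gk m r d := by
  unfold gk
  rw [← mul_pow]
  apply pow_le_pow_left₀ (gk_base_pos (by linarith) d).le
  have h1 : 0 < max r d := lt_max_of_lt_left hr
  rw [mul_div_assoc, mul_le_mul_iff_right₀ (by norm_num)]
  apply div_le_div_of_nonneg_left hr.le h1
  exact max_le_max (by linarith) le_rfl

lemma gk_shift (m : ℕ) {r : ℝ} (hr : 0 < r) {d e : ℝ} (h : e ≤ d + r) :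
    gk m r d ≤ 2 ^ m * gk m r e := by
  unfold gk
  rw [← mul_pow]
  apply pow_le_pow_left₀ (gk_base_pos hr d).le
  have h1 : 0 < max r d := lt_max_of_lt_left hr
  have h2 : 0 < max r e := lt_max_of_lt_left hr
  rw [← mul_div_assoc, div_le_div_iff₀ h1 h2]
  have : max r e ≤ 2 * max r d := by
    apply max_le
    · linarith [le_max_left r d]
    · linarith [le_max_left r d, le_max_right r d]
  nlinarith

lemma convPhi_eq (m : ℕ) (μ : Measure (EuclideanSpace ℝ (Fin n))) {r : ℝ} (hr : 0 < r)
    (x : EuclideanSpace ℝ (Fin n)) : convPhi m μ x r = (AA m μ r x).toReal := by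
  unfold convPhi AA
  simp_rw [gk_eq m hr (norm_nonneg _), ← dist_eq_norm]
  rw [integral_eq_lintegral_of_nonneg_ae]
  · exact Eventually.of_forall fun y => gk_nonneg m hr _
  · unfold gk
    apply Measurable.aestronglyMeasurable
    fun_prop

lemma AA_lt_top (m : ℕ) (μ : Measure (EuclideanSpace ℝ (Fin n))) [IsFiniteMeasure μ] {r : ℝ}
    (hr : 0 < r) (x : EuclideanSpace ℝ (Fin n)) : AA m μ r x < ⊤ := by
  unfold AA
  calc _ ≤ ∫⁻ y, 1 ∂μ := by
        apply lintegral_mono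
        intro y
        simpa using gk_le_one m hr _
    _ < ⊤ := by simp

lemma AA_mono (m : ℕ) (μ : Measure (EuclideanSpace ℝ (Fin n))) {r t : ℝ} (hr : 0 < r)
    (hrt : r ≤ t) (x : EuclideanSpace ℝ (Fin n)) : AA m μ r x ≤ AA m μ t x := by
  unfold AA
  exact lintegral_mono fun y => ENNReal.ofReal_le_ofReal (gk_mono m hr hrt _)

lemma AA_double (m : ℕ) (μ : Measure (EuclideanSpace ℝ (Fin n))) {r : ℝ} (hr : 0 < r)
    (x : EuclideanSpace ℝ (Fin n)) :
    AA m μ (2 * r) x ≤ ENNReal.ofReal (2 ^ m) * AA m μ r x := by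
  unfold AA
  rw [← lintegral_const_mul' _ _ ENNReal.ofReal_ne_top]
  refine lintegral_mono fun y => ?_
  rw [← ENNReal.ofReal_mul (by positivity)]
  exact ENNReal.ofReal_le_ofReal (gk_double m hr _)

lemma AA_shift (m : ℕ) (μ : Measure (EuclideanSpace ℝ (Fin n))) {r : ℝ} (hr : 0 < r)
    {x z : EuclideanSpace ℝ (Fin n)} (h : dist x z ≤ r) :
    AA m μ r x ≤ ENNReal.ofReal (2 ^ m) * AA m μ r z := by
  unfold AA
  rw [← lintegral_const_mul' _ _ ENNReal.ofReal_ne_top]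
  refine lintegral_mono fun y => ?_
  rw [← ENNReal.ofReal_mul (by positivity)]
  apply ENNReal.ofReal_le_ofReal (gk_shift m hr _)
  have := dist_triangle z x y
  rw [dist_comm z x] at this
  linarith

lemma ball_le_AA (m : ℕ) (μ : Measure (EuclideanSpace ℝ (Fin n))) {r : ℝ} (hr : 0 < r)
    (x : EuclideanSpace ℝ (Fin n)) : μ (ball x r) ≤ AA m μ r x := by
  unfold AA
  rw [← lintegral_indicator_one measurableSet_ball]
  refine lintegral_mono fun y => ?_
  by_cases hy : y ∈ ball x r
  · rw [indicator_of_mem hy]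
    have : dist x y ≤ r := by rw [dist_comm]; exact (mem_ball.1 hy).le
    unfold gk
    rw [max_eq_left this, div_self hr.ne']
    simp
  · rw [indicator_of_notMem hy]
    exact zero_le

lemma AA_meas (m : ℕ) (μ : Measure (EuclideanSpace ℝ (Fin n))) [IsFiniteMeasure μ] (r : ℝ) :
    Measurable (AA m μ r) :=
  Measurable.lintegral_prod_right' (gk_meas m r)

lemma ball_meas (μ : Measure (EuclideanSpace ℝ (Fin n))) [IsFiniteMeasure μ] (r : ℝ) :
    Measurable (fun x => μ (ball x r)) := by
  have hs : MeasurableSet {p : EuclideanSpace ℝ (Fin n) × EuclideanSpace ℝ (Fin n) |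
      dist p.2 p.1 < r} := measurableSet_lt (by fun_prop) (by fun_prop)
  exact measurable_measure_prodMk_left hs

lemma ae_mem_support (μ : Measure (EuclideanSpace ℝ (Fin n))) :
    ∀ᵐ x ∂μ, x ∈ measureSupport μ := by
  rw [ae_iff]
  apply measure_null_of_locally_null
  intro x hx
  simp only [measureSupport, mem_ofPred_eq, not_forall, not_lt, nonpos_iff_eq_zero] at hx
  obtain ⟨U, hU, hxU, h0⟩ := hx
  exact ⟨U, mem_nhdsWithin_of_mem_nhds (hU.mem_nhds hxU), h0⟩

/-- Layer bound for the kernel. -/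
lemma gk_layer (m : ℕ) {s : ℝ} (hs : 0 < s) (hsm : s ≤ m) (j : ℕ) {d : ℝ} (hd : 0 ≤ d) :
    gk m ((1 / 2) ^ j) d ≤ (((1 / 2 : ℝ) ^ j) ^ s) + ∑ k ∈ Finset.range (j + 1),
      (if d < (1 / 2) ^ k then ((1 / 2 : ℝ) ^ j) ^ s * 2 ^ s / ((1 / 2 : ℝ) ^ k) ^ s else 0) := by
  have hr : (0 : ℝ) < (1 / 2) ^ j := by positivity
  set r : ℝ := (1 / 2) ^ j with hrdef
  have hnn : ∀ k ∈ Finset.range (j + 1), (0 : ℝ) ≤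
      (if d < (1 / 2) ^ k then r ^ s * 2 ^ s / ((1 / 2 : ℝ) ^ k) ^ s else 0) := by
    intro k _
    split_ifs <;> positivity
  have hb : gk m r d ≤ (r / max r d) ^ s := by
    unfold gk
    rw [← Real.rpow_natCast]
    exact Real.rpow_le_rpow_of_exponent_ge (gk_base_pos hr d) (gk_base_le_one hr d) hsm
  have hrs : 0 ≤ r ^ s := by positivity
  rcases le_or_gt 1 d with h1 | h1
  · have : (r / max r d) ^ s ≤ r ^ s := by
      apply Real.rpow_le_rpow (gk_base_pos hr d).le _ hs.le
      apply div_le_self hr.le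
      exact h1.trans (le_max_right _ _)
    linarith [Finset.sum_nonneg hnn]
  · rcases lt_or_ge d r with h2 | h2
    · have hmem : j ∈ Finset.range (j + 1) := by simp
      have := Finset.single_le_sum hnn hmem
      rw [if_pos h2] at this
      have h3 : r ^ s * 2 ^ s / ((1 / 2 : ℝ) ^ j) ^ s = 2 ^ s := by
        rw [← hrdef]
        field_simp
      rw [h3] at this
      have h4 : (1 : ℝ) ≤ 2 ^ s := Real.one_le_rpow (by norm_num) hs.le
      linarith [gk_le_one m hr d]
    · have hd0 : 0 < d := hr.trans_le h2
      obtain ⟨k, hkj, hk1, hk2⟩ : ∃ k : ℕ, k ≤ j ∧ (1 / 2 : ℝ) ^ (k + 1) ≤ d ∧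
          d < (1 / 2 : ℝ) ^ k := by
        obtain ⟨k, hk1, hk2⟩ := exists_nat_pow_near_of_lt_one hd0 h1.le
          (by norm_num : (0 : ℝ) < 1 / 2) (by norm_num)
        have hkj : k ≤ j := by
          have : (1 / 2 : ℝ) ^ j ≤ (1 / 2) ^ k := h2.trans hk2
          exact (pow_le_pow_iff_right_of_lt_one₀ (by norm_num) (by norm_num)).1 this
        rcases lt_or_eq_of_le hk2 with h | h
        · exact ⟨k, hkj, hk1.le, h⟩
        · rcases k with _ | k
          · simp at h
            linarith
          · refine ⟨k, by omega, h.ge, ?_⟩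
            rw [h, pow_succ]
            have : (0 : ℝ) < (1 / 2) ^ k := by positivity
            linarith
      have hmem : k ∈ Finset.range (j + 1) := by simp; omega
      have := Finset.single_le_sum hnn hmem
      rw [if_pos hk2] at this
      have h5 : (r / max r d) ^ s ≤ r ^ s * 2 ^ s / ((1 / 2 : ℝ) ^ k) ^ s := by
        rw [max_eq_right h2, ← Real.mul_rpow hr.le (by norm_num),
          ← Real.div_rpow (by positivity) (by positivity)]
        apply Real.rpow_le_rpow (by positivity) _ hs.le
        have h6 : (0 : ℝ) < (1 / 2) ^ k := by positivity
        rw [div_le_div_iff₀ hd0 h6]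
        rw [pow_succ] at hk1
        nlinarith
      linarith

lemma lam_bound (m : ℕ) {s : ℝ} (hs : 0 < s) (hsm : s ≤ m)
    (lam : Measure (EuclideanSpace ℝ (Fin n))) [IsFiniteMeasure lam] {C : ℝ} (hC : 1 ≤ C)
    (y : EuclideanSpace ℝ (Fin n))
    (h : ∀ r : ℝ, 0 < r → r ≤ 1 → lam (ball y r) ≤ ENNReal.ofReal (C * r ^ s)) (j : ℕ) :
    ∫⁻ z, ENNReal.ofReal (gk m ((1 / 2) ^ j) (dist z y)) ∂lam ≤
      ENNReal.ofReal (((1 / 2 : ℝ) ^ j) ^ s *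
        ((lam univ).toReal + (j + 1) * (2 ^ s * C))) := by
  set r : ℝ := (1 / 2) ^ j with hrdef
  have hr : 0 < r := by positivity
  calc _ ≤ ∫⁻ z, (ENNReal.ofReal (r ^ s) + ∑ k ∈ Finset.range (j + 1),
        (ball y ((1 / 2) ^ k)).indicator
          (fun _ => ENNReal.ofReal (r ^ s * 2 ^ s / ((1 / 2 : ℝ) ^ k) ^ s)) z) ∂lam := by
        refine lintegral_mono fun z => ?_
        refine (ENNReal.ofReal_le_ofReal
          (gk_layer m hs hsm j (dist_nonneg (x := z) (y := y)))).trans ?_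
        rw [ENNReal.ofReal_add (by positivity)
          (Finset.sum_nonneg fun k _ => by split_ifs <;> positivity),
          ENNReal.ofReal_sum_of_nonneg (fun k _ => by split_ifs <;> positivity)]
        gcongr with k hk
        by_cases hz : dist z y < (1 / 2) ^ k
        · rw [if_pos hz, indicator_of_mem (mem_ball.2 hz)]
        · rw [if_neg hz]
          simp
    _ = ENNReal.ofReal (r ^ s) * lam univ + ∑ k ∈ Finset.range (j + 1),
          ENNReal.ofReal (r ^ s * 2 ^ s / ((1 / 2 : ℝ) ^ k) ^ s) * lam (ball y ((1 / 2) ^ k)) := by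
        rw [lintegral_add_left measurable_const, lintegral_const, lintegral_finsetSum]
        · congr 1
          refine Finset.sum_congr rfl fun k _ => ?_
          rw [lintegral_indicator_const measurableSet_ball]
        · intro k _
          exact measurable_const.indicator measurableSet_ball
    _ ≤ ENNReal.ofReal (r ^ s * (lam univ).toReal) + ∑ k ∈ Finset.range (j + 1),
          ENNReal.ofReal (r ^ s * (2 ^ s * C)) := by
        gcongr with k hk
        · rw [ENNReal.ofReal_mul (by positivity), ENNReal.ofReal_toReal (measure_ne_top _ _)]
        · have hk0 : (0 : ℝ) < (1 / 2) ^ k := by positivity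
          refine (mul_le_mul_right (h _ hk0 (pow_le_one₀ (by norm_num) (by norm_num))) _).trans ?_
          rw [← ENNReal.ofReal_mul (by positivity)]
          apply ENNReal.ofReal_le_ofReal
          apply le_of_eq
          field_simp
    _ = _ := by
        rw [Finset.sum_const, Finset.card_range, nsmul_eq_mul, mul_add,
          ENNReal.ofReal_add (by positivity) (by positivity)]
        congr 1
        rw [← ENNReal.ofReal_natCast, ← ENNReal.ofReal_mul (by positivity)]
        congr 1
        push_cast
        ring

/-- The integral of the ratio. -/
lemma ratio_bound (m : ℕ) {s : ℝ} (hs : 0 < s) (hsm : s ≤ m)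
    (μ : Measure (EuclideanSpace ℝ (Fin n))) [IsProbabilityMeasure μ]
    (lam : Measure (EuclideanSpace ℝ (Fin n))) [IsFiniteMeasure lam] {C : ℝ} (hC : 1 ≤ C)
    (h : ∀ x ∈ measureSupport μ, ∀ r : ℝ, 0 < r → r ≤ 1 →
      lam (ball x r) ≤ ENNReal.ofReal (C * r ^ s))
    (h' : ∀ x ∈ measureSupport μ, ∀ r : ℝ, 0 < r → r ≤ 1 / 2 →
      ENNReal.ofReal (C⁻¹ * r ^ s) ≤ lam (ball x r)) (j : ℕ) :
    ∫⁻ x, AA m μ ((1 / 2) ^ j) x / μ (ball x ((1 / 2) ^ j)) ∂μ ≤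
      ENNReal.ofReal (C * 2 ^ s * 2 ^ m * ((lam univ).toReal + (j + 1) * (2 ^ s * C))) := by
  set r : ℝ := (1 / 2) ^ j with hrdef
  have hr : 0 < r := by positivity
  have hr1 : r ≤ 1 := pow_le_one₀ (by norm_num) (by norm_num)
  have hC0 : 0 < C := by linarith
  set c : ℝ := C * (r / 2)⁻¹ ^ s with hc
  have hc0 : 0 ≤ c := by positivity
  set H : EuclideanSpace ℝ (Fin n) → ℝ≥0∞ := fun x => AA m μ r x / μ (ball x r) with hH
  have hHm : Measurable H := (AA_meas m μ r).div (ball_meas μ r)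
  have hS : MeasurableSet {p : EuclideanSpace ℝ (Fin n) × EuclideanSpace ℝ (Fin n) |
      dist p.2 p.1 < r / 2} := measurableSet_lt (by fun_prop) (by fun_prop)
  calc ∫⁻ x, H x ∂μ ≤ ∫⁻ x, ENNReal.ofReal c * (H x * lam (ball x (r / 2))) ∂μ := by
        apply lintegral_mono_ae
        filter_upwards [ae_mem_support μ] with x hx
        have h1 := h' x hx (r / 2) (by linarith) (by linarith)
        have h2 : 1 ≤ ENNReal.ofReal c * lam (ball x (r / 2)) := by
          refine le_trans ?_ (mul_le_mul_right h1 _)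
          rw [← ENNReal.ofReal_mul hc0, ← ENNReal.ofReal_one]
          apply ENNReal.ofReal_le_ofReal
          apply le_of_eq
          rw [hc, Real.inv_rpow (by positivity)]
          field_simp
        calc H x = H x * 1 := (mul_one _).symm
          _ ≤ H x * (ENNReal.ofReal c * lam (ball x (r / 2))) := by gcongr
          _ = _ := by ring
    _ = ENNReal.ofReal c * ∫⁻ x, ∫⁻ z, (ball x (r / 2)).indicator (fun _ => H x) z ∂lam ∂μ := by
        rw [lintegral_const_mul' _ _ ENNReal.ofReal_ne_top]
        congr 1
        refine lintegral_congr fun x => ?_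
        rw [lintegral_indicator_const measurableSet_ball]
    _ = ENNReal.ofReal c * ∫⁻ z, ∫⁻ x, (ball x (r / 2)).indicator (fun _ => H x) z ∂μ ∂lam := by
        congr 1
        apply lintegral_lintegral_swap
        apply Measurable.aemeasurable
        exact Measurable.indicator (f := fun p : EuclideanSpace ℝ (Fin n) ×
          EuclideanSpace ℝ (Fin n) => H p.1) (hHm.comp measurable_fst) hS
    _ ≤ ENNReal.ofReal c * ∫⁻ z, ENNReal.ofReal (2 ^ m) * AA m μ r z ∂lam := by
        gcongr with z
        calc _ ≤ ∫⁻ x, (ball z (r / 2)).indicator (fun _ =>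
              ENNReal.ofReal (2 ^ m) * AA m μ r z / μ (ball z (r / 2))) x ∂μ := by
              refine lintegral_mono fun x => ?_
              by_cases hz : dist z x < r / 2
              · rw [indicator_of_mem (mem_ball.2 hz),
                  indicator_of_mem (mem_ball.2 (by rwa [dist_comm]))]
                simp only [hH]
                apply ENNReal.div_le_div
                · apply AA_shift m μ hr
                  rw [dist_comm]
                  linarith
                · apply measure_mono
                  apply ball_subset_ball'
                  linarith
              · rw [indicator_of_notMem (by simpa using hz)]
                exact zero_le
          _ = ENNReal.ofReal (2 ^ m) * AA m μ r z / μ (ball z (r / 2)) * μ (ball z (r / 2)) := by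
              rw [lintegral_indicator_const measurableSet_ball]
          _ ≤ _ := by
              rw [div_eq_mul_inv, mul_assoc]
              exact mul_le_of_le_one_right zero_le (ENNReal.inv_mul_le_one _)
    _ = ENNReal.ofReal c * (ENNReal.ofReal (2 ^ m) *
          ∫⁻ y, ∫⁻ z, ENNReal.ofReal (gk m r (dist z y)) ∂lam ∂μ) := by
        rw [lintegral_const_mul' _ _ ENNReal.ofReal_ne_top]
        congr 2
        exact lintegral_lintegral_swap (gk_meas m r).aemeasurable
    _ ≤ ENNReal.ofReal c * (ENNReal.ofReal (2 ^ m) * ∫⁻ y, ENNReal.ofReal (r ^ s *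
        ((lam univ).toReal + (j + 1) * (2 ^ s * C))) ∂μ) := by
        refine mul_le_mul_right (mul_le_mul_right ?_ _) _
        apply lintegral_mono_ae
        filter_upwards [ae_mem_support μ] with y hy
        exact lam_bound m hs hsm lam hC y (h y hy) j
    _ = _ := by
        rw [lintegral_const, measure_univ (μ := μ), mul_one, ← ENNReal.ofReal_mul (by positivity),
          ← ENNReal.ofReal_mul hc0]
        congr 1
        rw [hc, Real.inv_rpow (by positivity), Real.div_rpow hr.le (by norm_num)]
        field_simp

/-- The lemma giving the restricted finite measure. -/
lemma exists_lam {s : ℝ} {K F : Set (EuclideanSpace ℝ (Fin n))} (hK : IsCompact K)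
    (hKF : K ⊆ F) (hF : IsAhlforsRegular s F) :
    ∃ (lam : Measure (EuclideanSpace ℝ (Fin n))) (C : ℝ), IsFiniteMeasure lam ∧ 1 ≤ C ∧
      (∀ x ∈ K, ∀ r : ℝ, 0 < r → r ≤ 1 → lam (ball x r) ≤ ENNReal.ofReal (C * r ^ s)) ∧
      (∀ x ∈ K, ∀ r : ℝ, 0 < r → r ≤ 1 / 2 → ENNReal.ofReal (C⁻¹ * r ^ s) ≤ lam (ball x r)) := by
  obtain ⟨_, lam, C, hC, _, hl⟩ := hF
  refine ⟨lam.restrict (thickening (1 / 2) K), C, ⟨?_⟩, hC, ?_, ?_⟩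
  · rw [Measure.restrict_apply_univ]
    obtain ⟨t, htK, htf, ht⟩ := hK.finite_cover_balls (e := 1 / 2) (by norm_num)
    have hsub : thickening (1 / 2) K ⊆ ⋃ x ∈ t, ball x 1 := by
      intro y hy
      obtain ⟨z, hz, hyz⟩ := mem_thickening_iff.1 hy
      obtain ⟨x, hx, hzx⟩ := mem_iUnion₂.1 (ht hz)
      refine mem_iUnion₂.2 ⟨x, hx, ?_⟩
      rw [mem_ball] at hzx ⊢
      linarith [dist_triangle y z x]
    refine (measure_mono hsub).trans_lt (measure_biUnion_lt_top htf fun x hx => ?_)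
    exact (hl x (hKF (htK hx)) 1 one_pos le_rfl).2.trans_lt ENNReal.ofReal_lt_top
  · intro x hx r hr hr1
    exact (Measure.restrict_apply_le _ _).trans (hl x (hKF hx) r hr hr1).2
  · intro x hx r hr hr1
    rw [Measure.restrict_apply measurableSet_ball, inter_eq_left.2]
    · exact (hl x (hKF hx) r hr (by linarith)).1
    · exact (ball_subset_ball hr1).trans (ball_subset_thickening hx _)

/-- Almost everywhere polynomial bound on the ratio at dyadic scales. -/
lemma ae_dyadic (m : ℕ) {s : ℝ} (hs : 0 < s) (hsm : s ≤ m)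
    (μ : Measure (EuclideanSpace ℝ (Fin n))) [IsProbabilityMeasure μ]
    (hK : IsCompact (measureSupport μ)) {F : Set (EuclideanSpace ℝ (Fin n))}
    (hF : IsAhlforsRegular s F) (hKF : measureSupport μ ⊆ F) :
    ∀ᵐ x ∂μ, ∃ M : ℝ, 0 < M ∧ ∀ j : ℕ, (AA m μ ((1 / 2) ^ j) x).toReal ≤
      M * (j + 1) ^ 3 * (μ (ball x ((1 / 2) ^ j))).toReal := by
  obtain ⟨lam, C, hfin, hC, h1, h2⟩ := exists_lam hK hKF hF
  set H : ℕ → EuclideanSpace ℝ (Fin n) → ℝ≥0∞ :=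
    fun j x => AA m μ ((1 / 2) ^ j) x / μ (ball x ((1 / 2) ^ j)) with hH
  have hHm : ∀ j, Measurable (H j) := fun j => (AA_meas m μ _).div (ball_meas μ _)
  set D : ℝ := C * 2 ^ s * 2 ^ m * ((lam univ).toReal + (2 ^ s * C)) with hD
  have hint : ∀ j, ∫⁻ x, H j x ∂μ ≤ ENNReal.ofReal (D * (j + 1)) := by
    intro j
    refine (ratio_bound m hs hsm μ lam hC h1 h2 j).trans (ENNReal.ofReal_le_ofReal ?_)
    rw [hD, mul_assoc _ _ ((j : ℝ) + 1)]
    gcongr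
    have : (0 : ℝ) ≤ (lam univ).toReal := ENNReal.toReal_nonneg
    have hj : (0 : ℝ) ≤ j := by positivity
    nlinarith
  have hsum : ∫⁻ x, ∑' j : ℕ, ENNReal.ofReal (((j : ℝ) + 1) ^ 3)⁻¹ * H j x ∂μ < ⊤ := by
    rw [lintegral_tsum fun j => ((hHm j).const_mul _).aemeasurable]
    have hsm' : Summable fun j : ℕ => D * (((j : ℝ) + 1) ^ 2)⁻¹ := by
      apply Summable.mul_left
      have := (summable_nat_add_iff 1).2 (Real.summable_nat_pow_inv.2 (by norm_num : 1 < 2))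
      simpa using this
    have hC0 : 0 < C := by linarith
    have hD0 : 0 ≤ D := by positivity
    refine lt_of_le_of_lt (ENNReal.tsum_le_tsum
      (g := fun j : ℕ => ENNReal.ofReal (D * (((j : ℝ) + 1) ^ 2)⁻¹)) fun j => ?_) ?_
    · rw [lintegral_const_mul' _ _ ENNReal.ofReal_ne_top]
      refine (mul_le_mul_right (hint j) _).trans ?_
      rw [← ENNReal.ofReal_mul (by positivity)]
      apply ENNReal.ofReal_le_ofReal
      apply le_of_eq
      field_simp
    · rw [← ENNReal.ofReal_tsum_of_nonneg (fun j => by positivity) hsm']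
      exact ENNReal.ofReal_lt_top
  have hae := ae_lt_top (Measurable.tsum fun j => (hHm j).const_mul _) hsum.ne
  filter_upwards [hae, ae_mem_support μ] with x hx hxs
  set T := ∑' j : ℕ, ENNReal.ofReal (((j : ℝ) + 1) ^ 3)⁻¹ * H j x with hT
  refine ⟨T.toReal + 1, by positivity, fun j => ?_⟩
  have hpos : 0 < μ (ball x ((1 / 2) ^ j)) :=
    hxs _ isOpen_ball (mem_ball_self (by positivity))
  have hle : ENNReal.ofReal (((j : ℝ) + 1) ^ 3)⁻¹ * H j x ≤ T := ENNReal.le_tsum j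
  have hreal := ENNReal.toReal_mono hx.ne hle
  rw [ENNReal.toReal_mul, ENNReal.toReal_ofReal (by positivity), hH, ENNReal.toReal_div] at hreal
  have hp : 0 < (μ (ball x ((1 / 2) ^ j))).toReal :=
    ENNReal.toReal_pos hpos.ne' (measure_ne_top _ _)
  rw [inv_mul_le_iff₀ (by positivity), div_le_iff₀ hp] at hreal
  refine hreal.trans ?_
  have h3 : (0 : ℝ) < ((j : ℝ) + 1) ^ 3 := by positivity
  rw [mul_comm (((j : ℝ) + 1) ^ 3)]
  gcongr
  linarith

/-- The logarithmic comparison. -/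
lemma ae_tendsto (m : ℕ) {s : ℝ} (hs : 0 < s) (hsm : s ≤ m)
    (μ : Measure (EuclideanSpace ℝ (Fin n))) [IsProbabilityMeasure μ]
    (hK : IsCompact (measureSupport μ)) {F : Set (EuclideanSpace ℝ (Fin n))}
    (hF : IsAhlforsRegular s F) (hKF : measureSupport μ ⊆ F) :
    ∀ᵐ x ∂μ, Tendsto (fun r : ℝ => (Real.log (convPhi m μ x r) -
      Real.log (μ (ball x r)).toReal) / Real.log r) (𝓝[>] 0) (𝓝 0) := by
  filter_upwards [ae_dyadic m hs hsm μ hK hF hKF, ae_mem_support μ] with x hx hxs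
  obtain ⟨M, hM, hx⟩ := hx
  have hbd : ∀ᶠ r : ℝ in 𝓝[>] 0, 0 ≤ Real.log (convPhi m μ x r) -
      Real.log (μ (ball x r)).toReal ∧ Real.log (convPhi m μ x r) -
      Real.log (μ (ball x r)).toReal ≤
        Real.log (2 ^ m * M * 8) + 3 * Real.log (1 + -Real.log r) := by
    filter_upwards [Ioo_mem_nhdsGT (show (0 : ℝ) < 1 by norm_num)] with r hr
    obtain ⟨hr0, hr1⟩ := hr
    have hL : 0 < -Real.log r := by linarith [Real.log_neg hr0 hr1]
    have hp : 0 < (μ (ball x r)).toReal :=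
      ENNReal.toReal_pos (hxs _ isOpen_ball (mem_ball_self hr0)).ne' (measure_ne_top _ _)
    rw [convPhi_eq m μ hr0]
    have hle : (μ (ball x r)).toReal ≤ (AA m μ r x).toReal :=
      ENNReal.toReal_mono (AA_lt_top m μ hr0 x).ne (ball_le_AA m μ hr0 x)
    refine ⟨sub_nonneg.2 (Real.log_le_log hp hle), ?_⟩
    obtain ⟨j, hj1, hj2⟩ := exists_nat_pow_near_of_lt_one hr0 hr1.le
        (by norm_num : (0 : ℝ) < 1 / 2) (by norm_num)
    have hj0 : (0 : ℝ) < (1 / 2) ^ (j + 1) := by positivity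
    have h1 : AA m μ r x ≤ ENNReal.ofReal (2 ^ m) * AA m μ ((1 / 2) ^ (j + 1)) x := by
      refine le_trans ?_ (AA_double m μ hj0 x)
      apply AA_mono m μ hr0
      rw [pow_succ]
      linarith
    have h2 : (AA m μ r x).toReal ≤ 2 ^ m * (AA m μ ((1 / 2) ^ (j + 1)) x).toReal := by
      have := ENNReal.toReal_mono
        (ENNReal.mul_ne_top ENNReal.ofReal_ne_top (AA_lt_top m μ hj0 x).ne) h1
      rwa [ENNReal.toReal_mul, ENNReal.toReal_ofReal (by positivity)] at this
    have h3 := hx (j + 1)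
    have h4 : (μ (ball x ((1 / 2) ^ (j + 1)))).toReal ≤ (μ (ball x r)).toReal :=
      ENNReal.toReal_mono (measure_ne_top _ _) (measure_mono (ball_subset_ball hj1.le))
    have h5 : (j : ℝ) ≤ 2 * -Real.log r := by
      have := Real.log_le_log hr0 hj2
      rw [Real.log_pow, one_div, Real.log_inv] at this
      have h6 := Real.log_two_gt_d9
      have hj : (0 : ℝ) ≤ j := by positivity
      nlinarith
    have h7 : (AA m μ r x).toReal ≤
        2 ^ m * M * 8 * (1 + -Real.log r) ^ 3 * (μ (ball x r)).toReal := by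
      calc _ ≤ _ := h2
        _ ≤ 2 ^ m * (M * (((j + 1 : ℕ) : ℝ) + 1) ^ 3 * (μ (ball x r)).toReal) := by
          gcongr
          refine h3.trans ?_
          gcongr
        _ ≤ 2 ^ m * (M * (2 * (1 + -Real.log r)) ^ 3 * (μ (ball x r)).toReal) := by
          gcongr
          push_cast
          linarith
        _ = _ := by ring
    have h8 := Real.log_le_log (hp.trans_le hle) h7
    rw [Real.log_mul (by positivity) hp.ne', Real.log_mul (by positivity) (by positivity),
      Real.log_pow] at h8
    push_cast at h8
    linarith
  have hlog : Tendsto (fun r : ℝ => -Real.log r) (𝓝[>] 0) atTop :=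
    tendsto_neg_atBot_atTop.comp Real.tendsto_log_nhdsGT_zero
  have hlim : Tendsto (fun t : ℝ => (Real.log (2 ^ m * M * 8) + 3 * Real.log (1 + t)) / t)
      atTop (𝓝 0) := by
    have e1 : Tendsto (fun t : ℝ => Real.log (2 ^ m * M * 8) / t) atTop (𝓝 0) :=
      tendsto_const_nhds.div_atTop tendsto_id
    have e2 : Tendsto (fun t : ℝ => Real.log (1 + t) / t) atTop (𝓝 0) := by
      have f1 : Tendsto (fun t : ℝ => Real.log (1 + t) / (1 + t)) atTop (𝓝 0) :=
        (Real.isLittleO_log_id_atTop.tendsto_div_nhds_zero).comp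
          (tendsto_atTop_add_const_left atTop 1 tendsto_id)
      have f2 : Tendsto (fun t : ℝ => 1 / t + 1) atTop (𝓝 (0 + 1)) :=
        (tendsto_const_nhds.div_atTop tendsto_id).add tendsto_const_nhds
      have f3 := f1.mul f2
      rw [zero_mul] at f3
      refine f3.congr' ?_
      filter_upwards [eventually_gt_atTop 0] with t ht
      field_simp
    have e3 := e1.add (e2.const_mul 3)
    rw [mul_zero, add_zero] at e3
    refine e3.congr fun t => ?_
    ring
  have hlim2 := (hlim.comp hlog).neg
  rw [neg_zero] at hlim2
  refine tendsto_of_tendsto_of_tendsto_of_le_of_le' hlim2 tendsto_const_nhds ?_ ?_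
  · filter_upwards [hbd, Ioo_mem_nhdsGT (show (0 : ℝ) < 1 by norm_num)] with r hb hr
    have hL : Real.log r < 0 := Real.log_neg hr.1 hr.2
    simp only [Function.comp_apply]
    rw [div_neg, neg_neg]
    exact (div_le_div_right_of_neg hL).2 hb.2
  · filter_upwards [hbd, Ioo_mem_nhdsGT (show (0 : ℝ) < 1 by norm_num)] with r hb hr
    have hL : Real.log r < 0 := Real.log_neg hr.1 hr.2
    exact div_nonpos_of_nonneg_of_nonpos hb.1 hL.le

lemma liminf_shift_aux {l : Filter ℝ} {u v : ℝ → ℝ}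
    (h : Tendsto (fun r => u r - v r) l (𝓝 0)) {a e : ℝ} (he : 0 < e)
    (ha : ∀ᶠ r in l, a ≤ u r) : ∀ᶠ r in l, a - e ≤ v r := by
  filter_upwards [ha, h.eventually (gt_mem_nhds he)] with r h1 h2
  linarith

lemma sSup_le_aux {A B : Set ℝ} (h1 : ∀ a ∈ A, ∀ e : ℝ, 0 < e → a - e ∈ B)
    (hB : BddAbove B) (hne : A.Nonempty) : sSup A ≤ sSup B := by
  apply csSup_le hne
  intro a ha
  apply le_of_forall_pos_le_add
  intro e he
  linarith [le_csSup hB (h1 a ha e he)]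

lemma bdd_aux {A B : Set ℝ} (h1 : ∀ a ∈ A, ∀ e : ℝ, 0 < e → a - e ∈ B)
    (hB : BddAbove B) : BddAbove A := by
  obtain ⟨b, hb⟩ := hB
  refine ⟨b + 1, fun a ha => ?_⟩
  linarith [hb (h1 a ha 1 one_pos)]

lemma liminf_congr_sub {l : Filter ℝ} {u v : ℝ → ℝ}
    (h : Tendsto (fun r => u r - v r) l (𝓝 0)) : liminf u l = liminf v l := by
  have h' : Tendsto (fun r => v r - u r) l (𝓝 0) := by
    have := h.neg
    rw [neg_zero] at this
    exact this.congr fun r => by ring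
  rw [liminf_eq, liminf_eq]
  set A := {a | ∀ᶠ r in l, a ≤ u r} with hA
  set B := {a | ∀ᶠ r in l, a ≤ v r} with hB
  have h1 : ∀ a ∈ A, ∀ e : ℝ, 0 < e → a - e ∈ B := fun a ha e he => liminf_shift_aux h he ha
  have h2 : ∀ a ∈ B, ∀ e : ℝ, 0 < e → a - e ∈ A := fun a ha e he => liminf_shift_aux h' he ha
  rcases A.eq_empty_or_nonempty with hAe | hAn
  · have : B = ∅ := by
      rw [eq_empty_iff_forall_notMem]
      intro b hb
      have := h2 b hb 1 one_pos
      rw [hAe] at this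
      exact this
    rw [hAe, this]
  · have hBn : B.Nonempty := hAn.imp' (fun a => a - 1) fun a ha => h1 a ha 1 one_pos
    by_cases hb : BddAbove B
    · exact le_antisymm (sSup_le_aux h1 hb hAn) (sSup_le_aux h2 (bdd_aux h1 hb) hBn)
    · have ha : ¬ BddAbove A := fun ha => hb (bdd_aux h2 ha)
      rw [Real.sSup_of_not_bddAbove ha, Real.sSup_of_not_bddAbove hb]

end Helpers

theorem stmt_14 (n m : ℕ) (hm : 1 ≤ m) (hmn : m < n) (s : ℝ) (hs : 0 < s) (hsm : s ≤ m)
    (μ : Measure (EuclideanSpace ℝ (Fin n))) [IsProbabilityMeasure μ]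
    (hμcompact : IsCompact (measureSupport μ))
    (F : Set (EuclideanSpace ℝ (Fin n))) (hF : IsAhlforsRegular s F)
    (hμsupp : measureSupport μ ⊆ F)
    (ν : Measure (EuclideanSpace ℝ (Fin n))) [IsProbabilityMeasure ν]
    (hνcompact : IsCompact (measureSupport ν))
    (hνsupp : measureSupport ν ⊆ measureSupport μ)
    (hac : ν ≪ μ) (q : ℝ) (hq : 0 < q) :
    ∀ᵐ x ∂ν, alphaConv q m μ ν x = alphaBall q μ ν x := by
  filter_upwards [hac.ae_le (ae_tendsto m hs hsm μ hμcompact hF hμsupp),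
    ae_tendsto m hs hsm ν hνcompact hF (hνsupp.trans hμsupp)] with x h1 h2
  unfold alphaConv alphaBall
  apply liminf_congr_sub
  have h3 := h2.sub (h1.const_mul q)
  rw [mul_zero, sub_zero] at h3
  refine h3.congr fun r => ?_
  ring
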